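/- arXiv:1610.03353 — 2 statements merged into one kernel-verified Lean document; each statement's English description precedes it below -/
import Mathlib

section
/- Let k be a commutative ring, M a k-module, and φ : M → M a k-linear automorphism. Let M[t,t⁻¹] denote the k-module of finitely supported functions from ℤ to M, written as formal Laurent polynomials Σᵢ mᵢ tⁱ with coefficients in M. Define the k-linear map ev : M[t,t⁻¹] → M by ev(Σᵢ mᵢ tⁱ) = Σᵢ φ^{−i}(mᵢ). Then: (a) ev is surjective; (b) the kernel of ev is exactly the image of the map (1 − tφ), which sends Σᵢ mᵢ tⁱ to Σᵢ (mᵢ − φ(m_{i−1})) tⁱ; and (c) ev intertwines multiplication by t on M[t,t⁻¹] (the shift Σᵢ mᵢ tⁱ ↦ Σᵢ mᵢ t^{i+1}) with φ⁻¹ on M. Consequently, the cokernel of (1 − tφ) is isomorphic to M, with the induced action of t on the cokernel corresponding to φ⁻¹ on M. -/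
/-- If a submodule of Laurent polynomials contains all `m tⁱ - φ(m) tⁱ⁺¹`, then modulo it
`φⁱ(m) tⁱ` agrees with the constant `m`. -/
theorem single_zpow_sub_single_zero_mem {k M : Type*} [CommRing k] [AddCommGroup M] [Module k M]
    (φ : M ≃ₗ[k] M) (N : Submodule k (ℤ →₀ M))
    (h : ∀ (i : ℤ) (m : M), Finsupp.single i m - Finsupp.single (i + 1) (φ m) ∈ N)
    (i : ℤ) (m : M) : Finsupp.single i ((φ ^ i) m) - Finsupp.single 0 m ∈ N := by
  induction i using Int.induction_on with
  | zero => simp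
  | succ n ih =>
    have e : (φ ^ ((n : ℤ) + 1)) m = φ ((φ ^ (n : ℤ)) m) := by
      rw [add_comm, zpow_add, zpow_one, LinearEquiv.mul_apply]
    rw [e]
    convert N.sub_mem ih (h n ((φ ^ (n : ℤ)) m)) using 1
    abel
  | pred n ih =>
    have e : φ ((φ ^ (-(n : ℤ) - 1)) m) = (φ ^ (-(n : ℤ))) m := by
      rw [← LinearEquiv.mul_apply, ← zpow_one_add, add_sub_cancel]
    have h' := h (-(n : ℤ) - 1) ((φ ^ (-(n : ℤ) - 1)) m)
    rw [e, sub_add_cancel] at h'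
    convert N.add_mem ih h' using 1
    abel


/-- Let `k` be a commutative ring, `M` a `k`-module, and `φ : M ≃ M` a
`k`-linear automorphism.  Let `M[t,t⁻¹] = (ℤ →₀ M)` be the module of formal Laurent
polynomials `Σᵢ mᵢ tⁱ` with coefficients in `M`.  Define `ev : M[t,t⁻¹] → M` by
`ev (Σᵢ mᵢ tⁱ) = Σᵢ φ^{−i}(mᵢ)`.  Then:
(a) `ev` is surjective;
(b) the kernel of `ev` is exactly the image of `1 − tφ`, the map sending
    `Σᵢ mᵢ tⁱ` to `Σᵢ (mᵢ − φ(m_{i−1})) tⁱ`;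
(c) `ev` intertwines multiplication by `t` (the shift `Σᵢ mᵢ tⁱ ↦ Σᵢ mᵢ t^{i+1}`)
    with `φ⁻¹` on `M`.
(Consequently the cokernel of `1 − tφ` is isomorphic to `M`, with `t` acting as `φ⁻¹`.) -/
theorem ev_surjective_ker_eq_range_and_intertwines (k : Type*) [CommRing k]
    (M : Type*) [AddCommGroup M] [Module k M] (φ : M ≃ₗ[k] M)
    (ev : (ℤ →₀ M) →ₗ[k] M)
    (hev : ∀ f : ℤ →₀ M, ev f = f.sum fun i m => (φ ^ (-i)) m)
    (T : (ℤ →₀ M) →ₗ[k] (ℤ →₀ M))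
    (hT : ∀ (f : ℤ →₀ M) (i : ℤ), T f i = f i - φ (f (i - 1)))
    (S : (ℤ →₀ M) →ₗ[k] (ℤ →₀ M))
    (hS : ∀ (f : ℤ →₀ M) (i : ℤ), S f i = f (i - 1)) :
    Function.Surjective ev ∧ LinearMap.ker ev = LinearMap.range T ∧
      ∀ f : ℤ →₀ M, ev (S f) = φ.symm (ev f) := by
  have ev_single (i : ℤ) (m : M) : ev (Finsupp.single i m) = (φ ^ (-i)) m := by
    rw [hev]
    exact Finsupp.sum_single_index (map_zero (φ ^ (-i)))
  have S_single (i : ℤ) (m : M) : S (Finsupp.single i m) = Finsupp.single (i + 1) m := by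
    ext j
    simp only [hS, Finsupp.single_apply, eq_sub_iff_add_eq]
  have ev_S (f : ℤ →₀ M) : ev (S f) = φ.symm (ev f) := by
    induction f using Finsupp.induction_linear with
    | zero => simp
    | add f g hf hg => simp only [map_add, hf, hg]
    | single i m =>
      rw [S_single, ev_single, ev_single, LinearEquiv.eq_symm_apply, ← LinearEquiv.mul_apply,
        ← zpow_one_add]
      congr 2
      ring
  have T_eq (f : ℤ →₀ M) : T f = f - S (f.mapRange φ (map_zero φ)) := by
    ext j
    simp [hT, hS]
  have ev_mapRange (f : ℤ →₀ M) : ev (f.mapRange φ (map_zero φ)) = φ (ev f) := by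
    rw [hev, hev, Finsupp.sum_mapRange_index (fun _ => map_zero _), map_finsuppSum]
    refine Finsupp.sum_congr fun i _ => ?_
    rw [← LinearEquiv.mul_apply, ← LinearEquiv.mul_apply, ((Commute.refl φ).zpow_left _).eq]
  have T_single (i : ℤ) (m : M) :
      Finsupp.single i m - Finsupp.single (i + 1) (φ m) ∈ LinearMap.range T :=
    ⟨Finsupp.single i m, by rw [T_eq, Finsupp.mapRange_single, S_single]⟩
  have sub_mem (f : ℤ →₀ M) : f - Finsupp.single 0 (ev f) ∈ LinearMap.range T := by
    induction f using Finsupp.induction_linear with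
    | zero => simp
    | add f g hf hg =>
      rw [map_add, Finsupp.single_add, add_sub_add_comm]
      exact Submodule.add_mem _ hf hg
    | single i m =>
      have h := single_zpow_sub_single_zero_mem φ _ T_single i ((φ ^ (-i)) m)
      rwa [← LinearEquiv.mul_apply, ← zpow_add, add_neg_cancel, zpow_zero,
        LinearEquiv.coe_one, id_eq, ← ev_single] at h
  refine ⟨fun m => ⟨Finsupp.single 0 m, by simp [ev_single]⟩, le_antisymm ?_ ?_, ev_S⟩
  · intro f hf
    simpa [LinearMap.mem_ker.mp hf] using sub_mem f
  · rintro _ ⟨f, rfl⟩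
    rw [LinearMap.mem_ker, T_eq, map_sub, ev_S, ev_mapRange, LinearEquiv.symm_apply_apply, sub_self]
end

section
/- Let k be a field and let R = k[t,t⁻¹] be the Laurent polynomial ring over k. Let M be a finitely generated R-module such that multiplication by (1 − t) is a bijection from M to M. Then M is a torsion R-module: every element of M is annihilated by some nonzero element of R. -/
/-- `1 - T n` is not a unit, since it vanishes under evaluation at `T = 1`. -/
theorem LaurentPolynomial.not_isUnit_one_sub_T (R : Type*) [CommRing R] [Nontrivial R] (n : ℤ) :
    ¬ IsUnit (1 - LaurentPolynomial.T n : LaurentPolynomial R) := by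
  intro h
  have h' := h.map (LaurentPolynomial.eval₂ (RingHom.id R) 1)
  simp at h'

/-- Let `k` be a field and `R = k[t,t⁻¹]` the Laurent polynomial ring over
`k`.  Let `M` be a finitely generated `R`-module such that multiplication by `1 − t` is a
bijection of `M`.  Then `M` is a torsion `R`-module: every element of `M` is annihilated by
some nonzero element of `R`. -/
theorem torsion_of_one_sub_t_bijective (k : Type*) [Field k]
    (M : Type*) [AddCommGroup M] [Module (LaurentPolynomial k) M]
    [Module.Finite (LaurentPolynomial k) M]
    (hbij : Function.Bijective fun m : M =>
      ((1 - LaurentPolynomial.T 1 : LaurentPolynomial k)) • m) :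
    ∀ m : M, ∃ r : LaurentPolynomial k, r ≠ 0 ∧ r • m = 0 := by
  intro m
  obtain ⟨r, hr, hrM⟩ := Submodule.exists_sub_one_mem_and_smul_eq_zero_of_fg_of_le_smul
    (Ideal.span {(1 - LaurentPolynomial.T 1 : LaurentPolynomial k)})
    (⊤ : Submodule (LaurentPolynomial k) M) Module.Finite.fg_top (by
      intro x _
      obtain ⟨y, rfl⟩ := hbij.surjective x
      exact Submodule.smul_mem_smul (Ideal.mem_span_singleton_self _) Submodule.mem_top)
  refine ⟨r, ?_, hrM m Submodule.mem_top⟩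
  rintro rfl
  rw [zero_sub, neg_mem_iff, Ideal.mem_span_singleton] at hr
  exact LaurentPolynomial.not_isUnit_one_sub_T k 1 (isUnit_of_dvd_one hr)
end
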